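/- Let n be a positive integer, ρ a density matrix on R⊗A, σ a density matrix on A, ω a density matrix on R, and p = (p₁,…,p_n) a probability vector. For each x ∈ {1,…,n} let τ_x = ρ^{RA_x} ⊗ (⊗_{i≠x} σ^{A_i}) on R⊗A₁⊗…⊗A_n (each A_i a copy of A), and let τ = Σ_{x=1}^n p_x τ_x. Then Q₂(τ ‖ ω ⊗ σ^{⊗n}) = (1−t)·Q₂(ρ^R ‖ ω) + t·Q₂(ρ^{RA} ‖ ω ⊗ σ), where t := Σ_{x=1}^n p_x² and ρ^R = Tr_A ρ. -/

import Mathlib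

open scoped Matrix Kronecker BigOperators ENNReal ComplexOrder Classical

noncomputable section

variable {d : Type*} [Fintype d] [DecidableEq d]

/-- Apply a real function to the eigenvalues of a Hermitian matrix (spectral
functional calculus). -/
def herFun {A : Matrix d d ℂ} (hA : A.IsHermitian) (f : ℝ → ℝ) : Matrix d d ℂ :=
  (hA.eigenvectorUnitary : Matrix d d ℂ) *
    Matrix.diagonal (fun i => (f (hA.eigenvalues i) : ℂ)) *
    (hA.eigenvectorUnitary : Matrix d d ℂ)ᴴ

/-- Functional calculus, extended by the junk value `0` to non-Hermitian matrices. -/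
def matFun (A : Matrix d d ℂ) (f : ℝ → ℝ) : Matrix d d ℂ :=
  if h : A.IsHermitian then herFun h f else 0

/-- Real power of a Hermitian matrix, taken on its support (Moore–Penrose
convention: zero eigenvalues are sent to zero; negative powers are pseudo-inverses). -/
def matPow (A : Matrix d d ℂ) (r : ℝ) : Matrix d d ℂ :=
  matFun A (fun x => if x = 0 then 0 else Real.rpow x r)

/-- Logarithm of a Hermitian matrix on its support. -/
def matLog (A : Matrix d d ℂ) : Matrix d d ℂ := matFun A Real.log

/-- A density matrix: positive semidefinite with unit trace. -/
def IsDensity (A : Matrix d d ℂ) : Prop := A.PosSemidef ∧ A.trace = 1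

/-- `suppLE ρ σ` : the support of `ρ` is contained in the support of `σ`
(for Hermitian matrices this is equivalent to `ker σ ≤ ker ρ`). -/
def suppLE (ρ σ : Matrix d d ℂ) : Prop :=
  LinearMap.ker σ.mulVecLin ≤ LinearMap.ker ρ.mulVecLin

/-- Trace (nuclear) norm of a matrix: `Tr √(AᴴA)`. -/
def traceNorm (A : Matrix d d ℂ) : ℝ := (Matrix.trace (matPow (Aᴴ * A) (1/2))).re

/-- The real-valued collision quantity `Tr[ρ σ^{-1/2} ρ σ^{-1/2}]`. -/
def Q2R (ρ σ : Matrix d d ℂ) : ℝ :=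
  (Matrix.trace (ρ * matPow σ (-(1/2)) * ρ * matPow σ (-(1/2)))).re

/-- `Q₂(ρ‖σ) = Tr[ρ σ^{-1/2} ρ σ^{-1/2}]`, equal to `+∞` unless `supp ρ ⊆ supp σ`. -/
def Q2 (ρ σ : Matrix d d ℂ) : ℝ≥0∞ :=
  if suppLE ρ σ then ENNReal.ofReal (Q2R ρ σ) else ∞

/-- Collision relative entropy `D₂(ρ‖σ) = log Q₂(ρ‖σ)`. -/
def D2 (ρ σ : Matrix d d ℂ) : EReal := ENNReal.log (Q2 ρ σ)

/-- Fidelity `F(ρ,σ) = ‖√ρ √σ‖₁`. -/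
def fidelity (ρ σ : Matrix d d ℂ) : ℝ := traceNorm (matPow ρ (1/2) * matPow σ (1/2))

/-- Purified distance `P(ρ,σ) = √(1 - F(ρ,σ)²)`. -/
def purifiedDist (ρ σ : Matrix d d ℂ) : ℝ := Real.sqrt (1 - fidelity ρ σ ^ 2)

variable {R A : Type*} [Fintype R] [DecidableEq R] [Fintype A] [DecidableEq A]

/-- Partial trace over the second tensor factor. -/
def ptrace2 (ρ : Matrix (R × A) (R × A) ℂ) : Matrix R R ℂ :=
  Matrix.of fun i j => ∑ a : A, ρ (i, a) (j, a)

/-- `n`-fold tensor power `σ^{⊗n}` of a matrix `σ`. -/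
def tpow (σ : Matrix A A ℂ) (n : ℕ) : Matrix (Fin n → A) (Fin n → A) ℂ :=
  Matrix.of fun v w => ∏ k, σ (v k) (w k)

/-- The state `τ_x = ρ^{R A_x} ⊗ (⊗_{i ≠ x} σ^{A_i})` on `R ⊗ A₁ ⊗ ⋯ ⊗ A_n`. -/
def tauX (ρ : Matrix (R × A) (R × A) ℂ) (σ : Matrix A A ℂ) (n : ℕ) (x : Fin n) :
    Matrix (R × (Fin n → A)) (R × (Fin n → A)) ℂ :=
  Matrix.of fun p q =>
    ρ (p.1, p.2 x) (q.1, q.2 x) * ∏ k ∈ Finset.univ.erase x, σ (p.2 k) (q.2 k)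


lemma matFun_eq_of {M U : Matrix d d ℂ} (c : d → ℝ) (h1 : Uᴴ * U = 1) (h2 : U * Uᴴ = 1)
    (hM : M = U * Matrix.diagonal (fun i => (c i : ℂ)) * Uᴴ) (f : ℝ → ℝ) :
    matFun M f = U * Matrix.diagonal (fun i => (f (c i) : ℂ)) * Uᴴ := by
  have hH : M.IsHermitian := by
    rw [hM]
    unfold Matrix.IsHermitian
    simp only [Matrix.conjTranspose_mul, Matrix.conjTranspose_conjTranspose,
      Matrix.diagonal_conjTranspose, Matrix.mul_assoc]
    congr 3
    ext i
    simp
  rw [matFun, dif_pos hH, herFun]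
  set W : Matrix d d ℂ := (hH.eigenvectorUnitary : Matrix d d ℂ) with hW
  have w1 : Wᴴ * W = 1 := Unitary.coe_star_mul_self hH.eigenvectorUnitary
  have w2 : W * Wᴴ = 1 := Unitary.coe_mul_star_self hH.eigenvectorUnitary
  have hs : M = W * Matrix.diagonal (fun i => (hH.eigenvalues i : ℂ)) * Wᴴ :=
    hH.spectral_theorem
  set e := hH.eigenvalues with he
  clear_value W e
  have key : Matrix.diagonal (fun i => (c i : ℂ)) * (Uᴴ * W)
      = (Uᴴ * W) * Matrix.diagonal (fun i => (e i : ℂ)) := by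
    have := hM.symm.trans hs
    have h3 := congrArg (fun X => Uᴴ * X * W) this
    simp only [Matrix.mul_assoc, w1, Matrix.mul_one] at h3
    rw [← Matrix.mul_assoc Uᴴ U, h1, Matrix.one_mul] at h3
    rw [h3, Matrix.mul_assoc]
  have key2 : Matrix.diagonal (fun i => (f (c i) : ℂ)) * (Uᴴ * W)
      = (Uᴴ * W) * Matrix.diagonal (fun i => (f (e i) : ℂ)) := by
    ext i j
    have := congrFun (congrFun key i) j
    rw [Matrix.diagonal_mul, Matrix.mul_diagonal] at this ⊢
    by_cases h : c i = e j
    · rw [h, mul_comm]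
    · have h0 : (Uᴴ * W) i j = 0 := by
        have : ((c i : ℂ) - e j) * (Uᴴ * W) i j = 0 := by linear_combination this
        rcases mul_eq_zero.1 this with h' | h'
        · exact absurd (by exact_mod_cast sub_eq_zero.1 h') h
        · exact h'
      rw [h0]; simp
  have h4 := congrArg (fun X => U * X * Wᴴ) key2
  simp only [Matrix.mul_assoc, w2, Matrix.mul_one] at h4
  rw [← Matrix.mul_assoc U Uᴴ, h2, Matrix.one_mul] at h4
  rw [Matrix.mul_assoc, ← h4, Matrix.mul_assoc]

lemma exists_diag {M : Matrix d d ℂ} (hM : M.PosSemidef) :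
    ∃ (U : Matrix d d ℂ) (c : d → ℝ), Uᴴ * U = 1 ∧ U * Uᴴ = 1 ∧ (∀ i, 0 ≤ c i) ∧
      M = U * Matrix.diagonal (fun i => (c i : ℂ)) * Uᴴ :=
  ⟨(hM.1.eigenvectorUnitary : Matrix d d ℂ), hM.1.eigenvalues,
    Unitary.coe_star_mul_self hM.1.eigenvectorUnitary,
    Unitary.coe_mul_star_self hM.1.eigenvectorUnitary, hM.eigenvalues_nonneg,
    hM.1.spectral_theorem⟩

/-- The scalar function behind `matPow`. -/
def pwf (r : ℝ) : ℝ → ℝ := fun x => if x = 0 then 0 else Real.rpow x r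

lemma pwf_nonneg (r : ℝ) {x : ℝ} (hx : 0 ≤ x) : 0 ≤ pwf r x := by
  unfold pwf
  split_ifs
  · exact le_rfl
  · exact Real.rpow_nonneg hx r

lemma pwf_mul (r : ℝ) {x y : ℝ} (hx : 0 ≤ x) (hy : 0 ≤ y) :
    pwf r (x * y) = pwf r x * pwf r y := by
  unfold pwf
  by_cases h : x = 0
  · simp [h]
  by_cases h' : y = 0
  · simp [h']
  simp only [h, h', mul_eq_zero, or_self, if_false]
  exact Real.mul_rpow hx hy

lemma pwf_prod (r : ℝ) {n : ℕ} (x : Fin n → ℝ) (hx : ∀ k, 0 ≤ x k) :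
    pwf r (∏ k, x k) = ∏ k, pwf r (x k) := by
  have : ∀ s : Finset (Fin n), pwf r (∏ k ∈ s, x k) = ∏ k ∈ s, pwf r (x k) := by
    intro s
    induction s using Finset.induction_on with
    | empty => simp [pwf]
    | insert a s ha ih =>
      rw [Finset.prod_insert ha, Finset.prod_insert ha,
        pwf_mul r (hx a) (Finset.prod_nonneg fun i _ => hx i), ih]
  exact this _

lemma pwf_half {x : ℝ} (hx : 0 ≤ x) :
    x * (pwf (-(1/2)) x * pwf (-(1/2)) x * x) = x := by
  unfold pwf
  by_cases h : x = 0
  · simp [h]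
  have hx' : 0 < x := lt_of_le_of_ne hx (Ne.symm h)
  simp only [h, if_false]
  have : Real.rpow x (-(1/2)) * Real.rpow x (-(1/2)) = x⁻¹ := by
    have := Real.rpow_add hx' (-(1/2)) (-(1/2))
    rw [show (-(1/2) + -(1/2) : ℝ) = -1 by norm_num, Real.rpow_neg_one] at this
    exact this.symm
  rw [this]; field_simp

/-! ### product matrices -/

/-- Tensor product of a family of matrices. -/
def pt {n : ℕ} (M : Fin n → Matrix A A ℂ) : Matrix (Fin n → A) (Fin n → A) ℂ :=
  Matrix.of fun v w => ∏ k, M k (v k) (w k)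

lemma tpow_eq_pt (s : Matrix A A ℂ) (n : ℕ) : tpow s n = pt (fun _ => s) := rfl

lemma pt_mul {n : ℕ} (M N : Fin n → Matrix A A ℂ) : pt M * pt N = pt (fun k => M k * N k) := by
  ext v w
  simp only [pt, Matrix.mul_apply, Matrix.of_apply, Fintype.prod_sum, ← Finset.prod_mul_distrib]

lemma pt_trace {n : ℕ} (M : Fin n → Matrix A A ℂ) : (pt M).trace = ∏ k, (M k).trace := by
  simp only [pt, Matrix.trace, Matrix.diag, Matrix.of_apply, Fintype.prod_sum]

lemma tpow_mul (a b : Matrix A A ℂ) (n : ℕ) : tpow a n * tpow b n = tpow (a * b) n := by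
  simp only [tpow_eq_pt, pt_mul]

lemma tpow_conjTranspose (a : Matrix A A ℂ) (n : ℕ) : (tpow a n)ᴴ = tpow aᴴ n := by
  ext v w
  simp [tpow, Matrix.conjTranspose_apply]

lemma tpow_diagonal (c : A → ℂ) (n : ℕ) :
    tpow (Matrix.diagonal c) n = Matrix.diagonal (fun v => ∏ k, c (v k)) := by
  ext v w
  simp only [tpow, Matrix.of_apply, Matrix.diagonal_apply]
  split_ifs with h
  · subst h; simp
  · obtain ⟨k, hk⟩ := Function.ne_iff.1 h
    exact Finset.prod_eq_zero (Finset.mem_univ k) (by simp [hk])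

lemma tpow_one (n : ℕ) : tpow (1 : Matrix A A ℂ) n = 1 := by
  rw [← Matrix.diagonal_one, tpow_diagonal, ← Matrix.diagonal_one]
  simp

lemma matPow_kron {M : Matrix R R ℂ} {N : Matrix A A ℂ} (hM : M.PosSemidef) (hN : N.PosSemidef)
    (r : ℝ) : matPow (M ⊗ₖ N) r = matPow M r ⊗ₖ matPow N r := by
  obtain ⟨U, c, u1, u2, hc, hU⟩ := exists_diag hM
  obtain ⟨V, e, v1, v2, he, hV⟩ := exists_diag hN
  have key : M ⊗ₖ N = (U ⊗ₖ V) * Matrix.diagonal (fun i : R × A => ((c i.1 * e i.2 : ℝ) : ℂ))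
      * (U ⊗ₖ V)ᴴ := by
    rw [Matrix.conjTranspose_kronecker]
    push_cast
    rw [← Matrix.diagonal_kronecker_diagonal (fun i => (c i : ℂ)) (fun i => (e i : ℂ)),
      ← Matrix.mul_kronecker_mul, ← Matrix.mul_kronecker_mul, ← hU, ← hV]
  have a := matFun_eq_of _ (by
      rw [Matrix.conjTranspose_kronecker, ← Matrix.mul_kronecker_mul, u1, v1,
        Matrix.one_kronecker_one]) (by
      rw [Matrix.conjTranspose_kronecker, ← Matrix.mul_kronecker_mul, u2, v2,
        Matrix.one_kronecker_one]) key (pwf r)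
  have b := matFun_eq_of _ u1 u2 hU (pwf r)
  have b' := matFun_eq_of _ v1 v2 hV (pwf r)
  change matFun _ (pwf r) = matFun _ (pwf r) ⊗ₖ matFun _ (pwf r)
  rw [a, b, b', Matrix.mul_kronecker_mul, Matrix.mul_kronecker_mul,
    Matrix.diagonal_kronecker_diagonal, Matrix.conjTranspose_kronecker]
  congr 3
  ext i
  rw [pwf_mul r (hc _) (he _)]
  push_cast; rfl

lemma matPow_tpow {N : Matrix A A ℂ} (hN : N.PosSemidef) (n : ℕ)
    (r : ℝ) : matPow (tpow N n) r = tpow (matPow N r) n := by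
  obtain ⟨V, e, v1, v2, he, hV⟩ := exists_diag hN
  have key : tpow N n = tpow V n * Matrix.diagonal
      (fun i : Fin n → A => ((∏ k, e (i k) : ℝ) : ℂ)) * (tpow V n)ᴴ := by
    push_cast
    rw [tpow_conjTranspose, ← tpow_diagonal (fun i => (e i : ℂ)), tpow_mul, tpow_mul, ← hV]
  have a := matFun_eq_of _ (by rw [tpow_conjTranspose, tpow_mul, v1, tpow_one])
    (by rw [tpow_conjTranspose, tpow_mul, v2, tpow_one]) key (pwf r)
  have b' := matFun_eq_of _ v1 v2 hV (pwf r)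
  change matFun _ (pwf r) = tpow (matFun _ (pwf r)) n
  rw [a, b', ← tpow_mul, ← tpow_mul, tpow_diagonal, tpow_conjTranspose]
  congr 3
  ext i
  rw [pwf_prod r _ (fun k => he _)]
  push_cast; rfl

lemma exists_sq {M : Matrix d d ℂ} (hM : M.PosSemidef) : ∃ B : Matrix d d ℂ, M = Bᴴ * B := by
  obtain ⟨U, c, u1, u2, hc, hU⟩ := exists_diag hM
  refine ⟨Matrix.diagonal (fun i => ((Real.sqrt (c i) : ℝ) : ℂ)) * Uᴴ, ?_⟩
  rw [Matrix.conjTranspose_mul, Matrix.conjTranspose_conjTranspose, Matrix.diagonal_conjTranspose,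
    Matrix.mul_assoc, ← Matrix.mul_assoc _ _ Uᴴ, Matrix.diagonal_mul_diagonal, ← Matrix.mul_assoc]
  conv_lhs => rw [hU]
  congr 3
  ext i
  simp only [Pi.star_apply, RCLike.star_def, Complex.conj_ofReal]
  rw [← Complex.ofReal_mul, Real.mul_self_sqrt (hc i)]

lemma tpow_posSemidef {N : Matrix A A ℂ} (hN : N.PosSemidef) (n : ℕ) : (tpow N n).PosSemidef := by
  obtain ⟨B, rfl⟩ := exists_sq hN
  rw [← tpow_mul, ← tpow_conjTranspose]
  exact Matrix.posSemidef_conjTranspose_mul_self _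

lemma kron_posSemidef {M : Matrix R R ℂ} {N : Matrix A A ℂ} (hM : M.PosSemidef)
    (hN : N.PosSemidef) : (M ⊗ₖ N).PosSemidef := by
  obtain ⟨B, rfl⟩ := exists_sq hM
  obtain ⟨C, rfl⟩ := exists_sq hN
  rw [Matrix.mul_kronecker_mul, ← Matrix.conjTranspose_kronecker]
  exact Matrix.posSemidef_conjTranspose_mul_self _

/-! ### support projection -/

/-- Support projection. -/
def prj (M : Matrix d d ℂ) : Matrix d d ℂ := matPow M (-(1/2)) * matPow M (-(1/2)) * M

lemma conj_mul_conj {U D E : Matrix d d ℂ} (h : Uᴴ * U = 1) :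
    (U * D * Uᴴ) * (U * E * Uᴴ) = U * (D * E) * Uᴴ := by
  calc (U * D * Uᴴ) * (U * E * Uᴴ) = U * D * (Uᴴ * U) * E * Uᴴ := by
        simp only [Matrix.mul_assoc]
    _ = _ := by rw [h]; simp only [Matrix.mul_assoc, Matrix.mul_one, Matrix.one_mul]

lemma prj_facts {M : Matrix d d ℂ} (hM : M.PosSemidef) :
    matPow M (-(1/2)) * M * matPow M (-(1/2)) = prj M ∧ M * prj M = M ∧
      prj M * prj M = prj M ∧ (matPow M (-(1/2))).PosSemidef := by
  obtain ⟨U, c, u1, u2, hc, hU⟩ := exists_diag hM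
  have hS : matPow M (-(1/2)) = U * Matrix.diagonal (fun i => ((pwf (-(1/2)) (c i) : ℝ) : ℂ)) * Uᴴ :=
    matFun_eq_of _ u1 u2 hU (pwf (-(1/2)))
  have hP : prj M = U * Matrix.diagonal
      (fun i => ((pwf (-(1/2)) (c i) * pwf (-(1/2)) (c i) * c i : ℝ) : ℂ)) * Uᴴ := by
    rw [prj, hS]
    conv_lhs => rw [hU]
    rw [conj_mul_conj u1, conj_mul_conj u1, Matrix.diagonal_mul_diagonal,
      Matrix.diagonal_mul_diagonal]
    congr 3; ext i; push_cast; ring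
  refine ⟨?_, ?_, ?_, ?_⟩
  · rw [hP, hS]
    conv_lhs => rw [hU]
    rw [conj_mul_conj u1, conj_mul_conj u1, Matrix.diagonal_mul_diagonal,
      Matrix.diagonal_mul_diagonal]
    congr 3; ext i; push_cast; ring
  · rw [hP]
    conv_rhs => rw [hU]
    conv_lhs => rw [hU]
    rw [conj_mul_conj u1, Matrix.diagonal_mul_diagonal]
    congr 3; ext i
    rw [← Complex.ofReal_mul, pwf_half (hc i)]
  · rw [hP, conj_mul_conj u1, Matrix.diagonal_mul_diagonal]
    congr 3; ext i
    rw [← Complex.ofReal_mul]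
    congr 1
    linear_combination (pwf (-(1/2)) (c i) * pwf (-(1/2)) (c i)) * pwf_half (hc i)
  · rw [hS]
    refine Matrix.PosSemidef.mul_mul_conjTranspose_same (Matrix.PosSemidef.diagonal ?_) U
    intro i
    exact Complex.zero_le_real.2 (pwf_nonneg _ (hc i))

lemma suppLE_iff (r : Matrix d d ℂ) {M : Matrix d d ℂ} (hM : M.PosSemidef) :
    suppLE r M ↔ r * prj M = r := by
  constructor
  · intro h
    have h0 : M * (1 - prj M) = 0 := by
      rw [Matrix.mul_sub, Matrix.mul_one, (prj_facts hM).2.1, sub_self]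
    have : r * (1 - prj M) = 0 := by
      apply Matrix.ext_of_mulVec_single
      intro i
      have h1 : ((1 - prj M) *ᵥ Pi.single i 1) ∈ LinearMap.ker M.mulVecLin := by
        rw [LinearMap.mem_ker, Matrix.mulVecLin_apply, Matrix.mulVec_mulVec, h0,
          Matrix.zero_mulVec]
      have h2 := h h1
      rw [LinearMap.mem_ker, Matrix.mulVecLin_apply, Matrix.mulVec_mulVec] at h2
      rw [h2, Matrix.zero_mulVec]
    rw [Matrix.mul_sub, Matrix.mul_one, sub_eq_zero] at this
    exact this.symm
  · intro h v hv
    rw [LinearMap.mem_ker, Matrix.mulVecLin_apply] at hv ⊢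
    rw [← h, prj, ← Matrix.mulVec_mulVec, ← Matrix.mulVec_mulVec, hv, Matrix.mulVec_zero,
      Matrix.mulVec_zero]

lemma prj_kron {M : Matrix R R ℂ} {N : Matrix A A ℂ} (hM : M.PosSemidef) (hN : N.PosSemidef) :
    prj (M ⊗ₖ N) = prj M ⊗ₖ prj N := by
  simp only [prj, matPow_kron hM hN, Matrix.mul_kronecker_mul]

lemma prj_tpow {N : Matrix A A ℂ} (hN : N.PosSemidef) (n : ℕ) :
    prj (tpow N n) = tpow (prj N) n := by
  simp only [prj, matPow_tpow hN, tpow_mul]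

lemma Q2R_nonneg {r M : Matrix d d ℂ} (hr : r.IsHermitian) (hM : M.PosSemidef) :
    0 ≤ Q2R r M := by
  obtain ⟨B, hB⟩ := exists_sq (prj_facts hM).2.2.2
  have : (r * matPow M (-(1/2)) * r * matPow M (-(1/2))).trace
      = ((B * r * Bᴴ)ᴴ * (B * r * Bᴴ)).trace := by
    rw [hB]
    simp only [Matrix.conjTranspose_mul, Matrix.conjTranspose_conjTranspose, hr.eq]
    rw [← Matrix.mul_assoc, Matrix.trace_mul_comm]
    simp only [Matrix.mul_assoc]
  rw [Q2R, this]
  exact (Complex.le_def.1 (Matrix.posSemidef_conjTranspose_mul_self (B * r * Bᴴ)).trace_nonneg).1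

/-! ### tauX -/

lemma kron_ind (P : Matrix (R × A) (R × A) ℂ → Prop)
    (hadd : ∀ M N, P M → P N → P (M + N)) (hk : ∀ X Y, P (X ⊗ₖ Y)) (M) : P M := by
  have : M = ∑ ab : A × A, (Matrix.of fun i j => M (i, ab.1) (j, ab.2)) ⊗ₖ
      (Matrix.single ab.1 ab.2 (1 : ℂ)) := by
    ext ⟨i, a⟩ ⟨j, b⟩
    rw [Matrix.sum_apply, Finset.sum_eq_single (a, b)]
    · simp
    · rintro ⟨a', b'⟩ - h
      rw [Matrix.kroneckerMap_apply, Matrix.single_apply_of_ne, mul_zero]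
      rintro ⟨rfl, rfl⟩
      exact h rfl
    · simp
  rw [this]
  apply Finset.sum_induction _ P hadd
  · have := hk 0 0
    rwa [Matrix.zero_kronecker] at this
  · intro x _
    exact hk _ _

lemma tauX_add (M N : Matrix (R × A) (R × A) ℂ) (s : Matrix A A ℂ) (n : ℕ) (x : Fin n) :
    tauX (M + N) s n x = tauX M s n x + tauX N s n x := by
  ext p q
  simp [tauX, add_mul]

lemma tauX_kron (X : Matrix R R ℂ) (Y s : Matrix A A ℂ) (n : ℕ) (x : Fin n) :
    tauX (X ⊗ₖ Y) s n x = X ⊗ₖ pt (Function.update (fun _ => s) x Y) := by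
  ext p q
  simp only [tauX, Matrix.of_apply, Matrix.kroneckerMap_apply, pt]
  rw [← Finset.mul_prod_erase _ _ (Finset.mem_univ x), Function.update_self, mul_assoc]
  congr 2
  refine Finset.prod_congr rfl fun k hk => ?_
  rw [Function.update_of_ne (Finset.ne_of_mem_erase hk)]

lemma tauX_kron_self (X : Matrix R R ℂ) (s : Matrix A A ℂ) (n : ℕ) (x : Fin n) :
    tauX (X ⊗ₖ s) s n x = X ⊗ₖ tpow s n := by
  rw [tauX_kron, tpow_eq_pt]
  congr 2
  exact Function.update_eq_self x (fun _ => s)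

lemma tauX_mul (M N : Matrix (R × A) (R × A) ℂ) (s t : Matrix A A ℂ) (n : ℕ) (x : Fin n) :
    tauX M s n x * tauX N t n x = tauX (M * N) (s * t) n x := by
  induction M using kron_ind with
  | hadd M M' h h' => rw [tauX_add, add_mul, add_mul, tauX_add, h, h']
  | hk X Y =>
    induction N using kron_ind with
    | hadd M M' h h' => rw [tauX_add, mul_add, mul_add, tauX_add, h, h']
    | hk X' Y' =>
      rw [← Matrix.mul_kronecker_mul, tauX_kron, tauX_kron, tauX_kron,
        ← Matrix.mul_kronecker_mul, pt_mul]
      congr 2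
      ext1 k
      by_cases h : k = x
      · subst h; simp
      · simp [h]

lemma tauX_conjTranspose (M : Matrix (R × A) (R × A) ℂ) (s : Matrix A A ℂ) (n : ℕ) (x : Fin n) :
    (tauX M s n x)ᴴ = tauX Mᴴ sᴴ n x := by
  ext p q
  simp [tauX, Matrix.conjTranspose_apply]

lemma tauX_posSemidef {M : Matrix (R × A) (R × A) ℂ} {s : Matrix A A ℂ} (hM : M.PosSemidef)
    (hs : s.PosSemidef) (n : ℕ) (x : Fin n) : (tauX M s n x).PosSemidef := by
  obtain ⟨B, rfl⟩ := exists_sq hM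
  obtain ⟨C, rfl⟩ := exists_sq hs
  rw [← tauX_mul, ← tauX_conjTranspose]
  exact Matrix.posSemidef_conjTranspose_mul_self _

lemma tauX_inj {M N : Matrix (R × A) (R × A) ℂ} {s : Matrix A A ℂ} (hs : s.trace = 1)
    {n : ℕ} {x : Fin n} (h : tauX M s n x = tauX N s n x) : M = N := by
  obtain ⟨a, ha⟩ : ∃ a, s a a ≠ 0 := by
    by_contra! hc
    have : s.trace = 0 := Finset.sum_eq_zero fun i _ => hc i
    rw [this] at hs
    exact zero_ne_one hs
  ext ⟨i, b⟩ ⟨j, c⟩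
  have := congrFun (congrFun h (i, Function.update (fun _ => a) x b))
    (j, Function.update (fun _ => a) x c)
  simp only [tauX, Matrix.of_apply, Function.update_self] at this
  refine mul_right_cancel₀ ?_ this
  rw [Finset.prod_ne_zero_iff]
  intro k hk
  rw [Function.update_of_ne (Finset.ne_of_mem_erase hk),
    Function.update_of_ne (Finset.ne_of_mem_erase hk)]
  exact ha

lemma ptrace2_add (M N : Matrix (R × A) (R × A) ℂ) :
    ptrace2 (M + N) = ptrace2 M + ptrace2 N := by
  ext i j
  simp [ptrace2, Finset.sum_add_distrib]

lemma ptrace2_kron (X : Matrix R R ℂ) (Y : Matrix A A ℂ) :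
    ptrace2 (X ⊗ₖ Y) = Y.trace • X := by
  ext i j
  simp [ptrace2, Matrix.trace, ← Finset.mul_sum, mul_comm]

lemma ptrace2_mul (M : Matrix (R × A) (R × A) ℂ) (X : Matrix R R ℂ) :
    ptrace2 (M * (X ⊗ₖ 1)) = ptrace2 M * X := by
  induction M using kron_ind with
  | hadd M M' h h' => rw [add_mul, ptrace2_add, ptrace2_add, add_mul, h, h']
  | hk X Y =>
    rw [← Matrix.mul_kronecker_mul, ptrace2_kron, ptrace2_kron, Matrix.mul_one,
      Matrix.smul_mul]

lemma ptrace2_isHermitian {M : Matrix (R × A) (R × A) ℂ} (hM : M.IsHermitian) :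
    (ptrace2 M).IsHermitian := by
  ext i j
  simp only [ptrace2, Matrix.conjTranspose_apply, Matrix.of_apply, star_sum]
  exact Finset.sum_congr rfl fun a _ => hM.apply _ _

lemma tr_same (M N : Matrix (R × A) (R × A) ℂ) (w : Matrix R R ℂ) (s t : Matrix A A ℂ) (n : ℕ)
    (x : Fin n) (h1 : (s * t * s * t).trace = 1) :
    (tauX M s n x * (w ⊗ₖ tpow t n) * tauX N s n x * (w ⊗ₖ tpow t n)).trace
      = (M * (w ⊗ₖ t) * N * (w ⊗ₖ t)).trace := by
  rw [← tauX_kron_self w t n x, tauX_mul, tauX_mul, tauX_mul]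
  induction (M * (w ⊗ₖ t) * N * (w ⊗ₖ t)) using kron_ind with
  | hadd M M' h h' => rw [tauX_add, Matrix.trace_add, Matrix.trace_add, h, h']
  | hk X Y =>
    rw [tauX_kron, Matrix.trace_kronecker, Matrix.trace_kronecker, pt_trace,
      ← Finset.mul_prod_erase _ _ (Finset.mem_univ x), Function.update_self,
      Finset.prod_eq_one, mul_one]
    intro k hk
    rw [Function.update_of_ne (Finset.ne_of_mem_erase hk), h1]

lemma tr_diff (M N : Matrix (R × A) (R × A) ℂ) (w : Matrix R R ℂ) (s t : Matrix A A ℂ) (n : ℕ)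
    (x y : Fin n) (hxy : x ≠ y) (h1 : (s * t * s * t).trace = 1) :
    (tauX M s n x * (w ⊗ₖ tpow t n) * tauX N s n y * (w ⊗ₖ tpow t n)).trace
      = (ptrace2 (M * (1 ⊗ₖ (t * s * t))) * w * ptrace2 (N * (1 ⊗ₖ (t * s * t))) * w).trace := by
  induction M using kron_ind with
  | hadd M M' h h' =>
    simp only [tauX_add, add_mul, Matrix.trace_add, ptrace2_add, h, h']
  | hk X Y =>
    induction N using kron_ind with
    | hadd M M' h h' =>
      simp only [tauX_add, add_mul, mul_add, Matrix.trace_add, ptrace2_add, h, h']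
    | hk X' Y' =>
      rw [tauX_kron, tauX_kron, tpow_eq_pt]
      simp only [← Matrix.mul_kronecker_mul, pt_mul, Matrix.trace_kronecker, pt_trace,
        ptrace2_kron, Matrix.mul_one, Matrix.smul_mul, Matrix.mul_smul, Matrix.trace_smul,
        smul_eq_mul]
      have : ∀ k, (Function.update (fun _ => s) x Y k * t * Function.update (fun _ => s) y Y' k
          * t).trace = (if k = x then (Y * (t * s * t)).trace else 1) *
            (if k = y then (Y' * (t * s * t)).trace else 1) := by
        intro k
        by_cases hx : k = x
        · subst hx
          simp [hxy, Matrix.mul_assoc]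
        · by_cases hy : k = y
          · subst hy
            simp only [hx, Function.update_self, Function.update_of_ne (Ne.symm hxy), if_true,
              if_false, one_mul]
            rw [Matrix.mul_assoc (s * t), Matrix.trace_mul_comm]
            simp only [Matrix.mul_assoc]
          · simp [hx, hy, h1]
      simp only [this, Finset.prod_mul_distrib, Finset.prod_ite_eq', Finset.mem_univ, if_true]
      ring

/-- Support of the mixture. -/
lemma supp_mix (n : ℕ)
    {r : Matrix (R × A) (R × A) ℂ} (hr : r.PosSemidef)
    {s : Matrix A A ℂ} (hs : IsDensity s)
    {w : Matrix R R ℂ} (hw : w.PosSemidef)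
    (p : Fin n → ℝ) (hp0 : ∀ x, 0 ≤ p x) (hp1 : ∑ x, p x = 1) :
    suppLE (∑ x : Fin n, (p x : ℂ) • tauX r s n x) (w ⊗ₖ tpow s n) ↔ suppLE r (w ⊗ₖ s) := by
  have hT := kron_posSemidef hw (tpow_posSemidef hs.1 n)
  have hmul : ∀ x, tauX r s n x * prj (w ⊗ₖ tpow s n) = tauX (r * prj (w ⊗ₖ s)) s n x := by
    intro x
    rw [prj_kron hw (tpow_posSemidef hs.1 n), prj_tpow hs.1, ← tauX_kron_self _ _ _ x, tauX_mul,
      (prj_facts hs.1).2.1, prj_kron hw hs.1]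
  constructor
  · intro h
    obtain ⟨x, hx⟩ : ∃ x, 0 < p x := by
      by_contra! hc
      have := Finset.sum_nonpos fun x (_ : x ∈ Finset.univ) => hc x
      linarith
    have hxs : suppLE (tauX r s n x) (w ⊗ₖ tpow s n) := by
      intro v hv
      have hv' := h hv
      rw [LinearMap.mem_ker, Matrix.mulVecLin_apply] at hv' ⊢
      have h0 : ∑ y, (p y : ℂ) * (star v ⬝ᵥ tauX r s n y *ᵥ v) = 0 := by
        have := congrArg (fun u => star v ⬝ᵥ u) hv'
        simpa only [Matrix.sum_mulVec, dotProduct_sum, Matrix.smul_mulVec, dotProduct_smul,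
          smul_eq_mul, dotProduct_zero] using this
      rw [Finset.sum_eq_zero_iff_of_nonneg] at h0
      · have h1 := h0 x (Finset.mem_univ x)
        rcases mul_eq_zero.1 h1 with h2 | h2
        · exact absurd (by exact_mod_cast h2) hx.ne'
        · exact ((tauX_posSemidef hr hs.1 n x).dotProduct_mulVec_zero_iff v).1 h2
      · intro y _
        exact mul_nonneg (Complex.zero_le_real.2 (hp0 y))
          ((tauX_posSemidef hr hs.1 n y).dotProduct_mulVec_nonneg v)
    rw [suppLE_iff _ hT, hmul] at hxs
    rw [suppLE_iff _ (kron_posSemidef hw hs.1)]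
    exact tauX_inj hs.2 hxs
  · intro h
    rw [suppLE_iff _ (kron_posSemidef hw hs.1)] at h
    rw [suppLE_iff _ hT, Finset.sum_mul]
    refine Finset.sum_congr rfl fun x _ => ?_
    rw [Matrix.smul_mul, hmul, h]

lemma supp_ptrace {r : Matrix (R × A) (R × A) ℂ} {s : Matrix A A ℂ} (hs : s.PosSemidef)
    {w : Matrix R R ℂ} (hw : w.PosSemidef) (h : suppLE r (w ⊗ₖ s)) :
    suppLE (ptrace2 r) w ∧ ptrace2 (r * (1 ⊗ₖ prj s)) = ptrace2 r := by
  rw [suppLE_iff _ (kron_posSemidef hw hs), prj_kron hw hs] at h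
  constructor
  · rw [suppLE_iff _ hw, ← ptrace2_mul]
    conv_lhs => rw [← h]
    rw [Matrix.mul_assoc, ← Matrix.mul_kronecker_mul, (prj_facts hw).2.2.1, Matrix.mul_one, h]
  · conv_lhs => rw [← h]
    rw [Matrix.mul_assoc, ← Matrix.mul_kronecker_mul, (prj_facts hs).2.2.1, Matrix.mul_one, h]

lemma Q2R_mix (n : ℕ)
    {r : Matrix (R × A) (R × A) ℂ}
    {s : Matrix A A ℂ} (hs : IsDensity s)
    {w : Matrix R R ℂ} (hw : w.PosSemidef) (h : suppLE r (w ⊗ₖ s))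
    (p : Fin n → ℝ) (hp1 : ∑ x, p x = 1) :
    Q2R (∑ x : Fin n, (p x : ℂ) • tauX r s n x) (w ⊗ₖ tpow s n)
      = (1 - ∑ x, p x ^ 2) * Q2R (ptrace2 r) w + (∑ x, p x ^ 2) * Q2R r (w ⊗ₖ s) := by
  unfold Q2R
  rw [matPow_kron hw (tpow_posSemidef hs.1 n), matPow_tpow hs.1, matPow_kron hw hs.1]
  have hP := (prj_facts hs.1).1
  have hsP := (prj_facts hs.1).2.1
  set S := matPow s (-(1/2))
  set W := matPow w (-(1/2))
  have h1 : (s * S * s * S).trace = 1 := by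
    rw [Matrix.mul_assoc, Matrix.mul_assoc, ← Matrix.mul_assoc S, hP, hsP, hs.2]
  have hterm : ∀ x y, (tauX r s n x * (W ⊗ₖ tpow S n) * tauX r s n y * (W ⊗ₖ tpow S n)).trace
      = (ptrace2 r * W * ptrace2 r * W).trace + (if x = y then
        (r * (W ⊗ₖ S) * r * (W ⊗ₖ S)).trace - (ptrace2 r * W * ptrace2 r * W).trace else 0) := by
    intro x y
    split_ifs with hxy
    · subst hxy
      rw [tr_same _ _ _ _ _ _ _ h1]; ring
    · rw [tr_diff _ _ _ _ _ _ _ _ hxy h1, hP, (supp_ptrace hs.1 hw h).2, add_zero]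
  have hsum : ((∑ x : Fin n, (p x : ℂ) • tauX r s n x) * (W ⊗ₖ tpow S n) *
      (∑ x : Fin n, (p x : ℂ) • tauX r s n x) * (W ⊗ₖ tpow S n)).trace
      = ∑ x, ∑ y, (p x : ℂ) * (p y : ℂ) *
        (tauX r s n x * (W ⊗ₖ tpow S n) * tauX r s n y * (W ⊗ₖ tpow S n)).trace := by
    simp only [Finset.sum_mul, Finset.mul_sum, Matrix.trace_sum, Matrix.smul_mul, Matrix.mul_smul,
      Matrix.trace_smul, smul_eq_mul]
    rw [Finset.sum_comm]
    refine Finset.sum_congr rfl fun x _ => Finset.sum_congr rfl fun y _ => ?_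
    ring
  rw [hsum]
  simp only [hterm]
  generalize (ptrace2 r * W * ptrace2 r * W).trace = a
  generalize (r * (W ⊗ₖ S) * r * (W ⊗ₖ S)).trace = b
  have : ∑ x, ∑ y, (p x : ℂ) * (p y : ℂ) * (a + if x = y then b - a else 0)
      = (((1 - ∑ x, p x ^ 2 : ℝ)) : ℂ) * a + ((∑ x, p x ^ 2 : ℝ) : ℂ) * b := by
    have hc : ∑ x, (p x : ℂ) = 1 := by exact_mod_cast congrArg (fun t : ℝ => (t : ℂ)) hp1
    simp only [mul_add, Finset.sum_add_distrib, mul_ite, mul_zero, Finset.sum_ite_eq,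
      Finset.mem_univ, if_true, ← Finset.sum_mul, ← Finset.mul_sum, hc, mul_one, one_mul]
    push_cast
    simp only [← pow_two]
    ring
  rw [this, Complex.add_re, Complex.re_ofReal_mul, Complex.re_ofReal_mul]

/-- **Weighted convex split lemma**: for a probability vector `p`,
`Q₂(Σ_x p_x τ_x ‖ ω ⊗ σ^{⊗n}) = (1−t)·Q₂(ρ^R‖ω) + t·Q₂(ρ^{RA}‖ω⊗σ)` with `t = Σ_x p_x²`. -/
theorem convex_split_equality_weighted (n : ℕ) (hn : 0 < n)
    (ρ : Matrix (R × A) (R × A) ℂ) (hρ : IsDensity ρ)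
    (σ : Matrix A A ℂ) (hσ : IsDensity σ)
    (ω : Matrix R R ℂ) (hω : IsDensity ω)
    (p : Fin n → ℝ) (hp0 : ∀ x, 0 ≤ p x) (hp1 : ∑ x, p x = 1) :
    Q2 (∑ x : Fin n, (p x : ℂ) • tauX ρ σ n x) (ω ⊗ₖ tpow σ n)
      = ENNReal.ofReal (1 - ∑ x, p x ^ 2) * Q2 (ptrace2 ρ) ω
        + ENNReal.ofReal (∑ x, p x ^ 2) * Q2 ρ (ω ⊗ₖ σ) := by
  have ht1 : ∑ x, p x ^ 2 ≤ 1 := by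
    rw [← hp1]
    refine Finset.sum_le_sum fun x _ => ?_
    have : p x ≤ 1 := by
      rw [← hp1]
      exact Finset.single_le_sum (fun i _ => hp0 i) (Finset.mem_univ x)
    nlinarith [hp0 x]
  have ht0 : 0 < ∑ x, p x ^ 2 := by
    refine lt_of_le_of_ne (Finset.sum_nonneg fun x _ => sq_nonneg _) fun h => ?_
    have h' := (Finset.sum_eq_zero_iff_of_nonneg fun x _ => sq_nonneg (p x)).1 h.symm
    have : ∑ x, p x = 0 := Finset.sum_eq_zero fun x hx => by simpa using h' x hx
    linarith
  by_cases h : suppLE ρ (ω ⊗ₖ σ)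
  · rw [Q2, Q2, Q2, if_pos h, if_pos ((supp_mix n hρ.1 hσ hω.1 p hp0 hp1).2 h),
      if_pos (supp_ptrace hσ.1 hω.1 h).1, Q2R_mix n hσ hω.1 h p hp1,
      ← ENNReal.ofReal_mul (by linarith), ← ENNReal.ofReal_mul ht0.le]
    exact ENNReal.ofReal_add
      (mul_nonneg (by linarith) (Q2R_nonneg (ptrace2_isHermitian hρ.1.1) hω.1))
      (mul_nonneg ht0.le (Q2R_nonneg hρ.1.1 (kron_posSemidef hω.1 hσ.1)))
  · have h' := fun hh => h ((supp_mix n hρ.1 hσ hω.1 p hp0 hp1).1 hh)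
    rw [Q2, if_neg h', Q2, Q2, if_neg h, ENNReal.mul_top (by simpa using ht0), add_top]
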